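/- arXiv:2205.14281 — 2 statements merged into one kernel-verified Lean document; each statement's English description precedes it below -/
import Mathlib

section
/- Let α be a type, m ≥ 1, and B : Fin m → Finset α a family of pairwise disjoint nonempty finite sets with union S (a nonempty Finset with S.card = ∑ᵢ (B i).card). For every PMF w on Fin m, the mixture w.bind (fun i => Uniform(B i)) equals Uniform(S) if and only if w(i) = (B i).card / S.card for every i ∈ Fin m. That is, scheduling requests from disjoint uniform sub-streams yields a uniform distribution over the union of their supports exactly when each sub-stream is scheduled with probability proportional to the number of keys it covers. -/
open scoped ENNReal

/-- At a point of the block `B i`, a mixture of uniform laws on pairwise disjoint blocks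
has mass `w i / (B i).card`. -/
theorem bind_uniformOfFinset_apply_of_mem {ι α : Type*} {B : ι → Finset α}
    (hdisj : ∀ i j, i ≠ j → Disjoint (B i) (B j)) (hne : ∀ i, (B i).Nonempty)
    (w : PMF ι) {i : ι} {x : α} (hx : x ∈ B i) :
    w.bind (fun i => PMF.uniformOfFinset (B i) (hne i)) x = w i / ((B i).card : ℝ≥0∞) := by
  rw [PMF.bind_apply, tsum_eq_single i, PMF.uniformOfFinset_apply_of_mem (hne i) hx,
    div_eq_mul_inv]
  intro j hj
  rw [PMF.uniformOfFinset_apply_of_notMem (hne j) (Finset.disjoint_left.1 (hdisj i j hj.symm) hx),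
    mul_zero]

/-- **Uniformity of the mixture characterizes proportional scheduling weights.**
For pairwise disjoint nonempty blocks `B : Fin m → Finset α` (with `m ≥ 1`) with union `S`,
and any PMF `w` on `Fin m`, the mixture `w.bind (fun i => Uniform(B i))` equals `Uniform(S)`
if and only if `w i = (B i).card / S.card` for every `i`. -/
theorem mixture_uniform_iff_proportional_weights
    {α : Type*} [DecidableEq α] (m : ℕ) (hm : 1 ≤ m)
    (B : Fin m → Finset α)
    (hdisj : ∀ i j, i ≠ j → Disjoint (B i) (B j))
    (hne : ∀ i, (B i).Nonempty)
    (S : Finset α) (hS : S = Finset.univ.biUnion B)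
    (hScard : S.card = ∑ i, (B i).card)
    (hSne : S.Nonempty)
    (w : PMF (Fin m)) :
    w.bind (fun i => PMF.uniformOfFinset (B i) (hne i)) =
        PMF.uniformOfFinset S hSne ↔
      ∀ i, w i = ((B i).card : ℝ≥0∞) / (S.card : ℝ≥0∞) := by
  have card_ne_zero (i : Fin m) : ((B i).card : ℝ≥0∞) ≠ 0 :=
    Nat.cast_ne_zero.2 (hne i).card_ne_zero
  have mem_S {i : Fin m} {x : α} (hx : x ∈ B i) : x ∈ S :=
    hS ▸ Finset.mem_biUnion.2 ⟨i, Finset.mem_univ i, hx⟩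
  have weight_iff (i : Fin m) : w i / ((B i).card : ℝ≥0∞) = (S.card : ℝ≥0∞)⁻¹ ↔
      w i = ((B i).card : ℝ≥0∞) / (S.card : ℝ≥0∞) := by
    rw [eq_comm, ENNReal.eq_div_iff (card_ne_zero i) (ENNReal.natCast_ne_top _), eq_comm,
      div_eq_mul_inv]
  constructor
  · intro h i
    obtain ⟨x, hx⟩ := hne i
    rw [← weight_iff, ← bind_uniformOfFinset_apply_of_mem hdisj hne w hx, h,
      PMF.uniformOfFinset_apply_of_mem hSne (mem_S hx)]
  · intro h
    ext x
    by_cases hx : ∃ i, x ∈ B i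
    · obtain ⟨i, hi⟩ := hx
      rw [bind_uniformOfFinset_apply_of_mem hdisj hne w hi,
        PMF.uniformOfFinset_apply_of_mem hSne (mem_S hi), weight_iff]
      exact h i
    · have hxS : x ∉ S := by simpa [hS] using hx
      rw [PMF.uniformOfFinset_apply_of_notMem hSne hxS, PMF.bind_apply, ENNReal.tsum_eq_zero]
      intro i
      rw [PMF.uniformOfFinset_apply_of_notMem (hne i) fun hi => hx ⟨i, hi⟩, mul_zero]
end

section
/- Let α be a type, m ≥ 1, and B : Fin m → Finset α a family of pairwise disjoint nonempty finite sets (the sets of ciphertext keys handled by the m L3 proxy servers). Let I ⊆ Fin m be any set of failed servers whose complement J = Fin m \ I is nonempty, and let S′ = ⋃_{i ∈ J} B i be the union of the surviving blocks (so S′.card = ∑_{i ∈ J} (B i).card). Then the mixture over surviving servers with renormalized proportional weights equals the uniform distribution on the surviving keys: letting w′ be the PMF on J with w′(i) = (B i).card / S′.card, one has w′.bind (fun i => Uniform(B i)) = Uniform(S′). Hence, after failure of any subset of the L3 servers, the adversary observes a uniform distribution over a subset of the original ciphertext keys. -/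
open scoped ENNReal

/-- **After L3 server failures, the observed distribution is uniform over surviving keys.**
Let `B : Fin m → Finset α` (with `m ≥ 1`) be the pairwise disjoint nonempty sets of
ciphertext keys handled by the `m` L3 servers, `I` a set of failed servers with nonempty
complement `J`, and `S'` the union of the surviving blocks. If `w'` is the PMF supported
on `J` with `w' i = (B i).card / S'.card` for `i ∈ J` (and `w' i = 0` for `i ∉ J`), then
`w'.bind (fun i => Uniform(B i)) = Uniform(S')`. -/
theorem surviving_mixture_uniform
    {α : Type*} [DecidableEq α] (m : ℕ) (hm : 1 ≤ m)
    (B : Fin m → Finset α)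
    (hdisj : ∀ i j, i ≠ j → Disjoint (B i) (B j))
    (hne : ∀ i, (B i).Nonempty)
    (I : Finset (Fin m)) (J : Finset (Fin m)) (hJ : J = Finset.univ \ I)
    (hJne : J.Nonempty)
    (S' : Finset α) (hS' : S' = J.biUnion B)
    (hS'card : S'.card = ∑ i ∈ J, (B i).card)
    (hS'ne : S'.Nonempty)
    (w' : PMF (Fin m))
    (hw'J : ∀ i ∈ J, w' i = ((B i).card : ℝ≥0∞) / (S'.card : ℝ≥0∞))
    (hw'I : ∀ i ∉ J, w' i = 0) :
    w'.bind (fun i => PMF.uniformOfFinset (B i) (hne i)) =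
      PMF.uniformOfFinset S' hS'ne := by
  ext x
  rw [PMF.bind_apply, tsum_fintype]
  by_cases hx : x ∈ S'
  · obtain ⟨i, hi, hxi⟩ : ∃ i ∈ J, x ∈ B i := by simpa [hS'] using hx
    have hcard : ((B i).card : ℝ≥0∞) ≠ 0 := by exact_mod_cast (hne i).card_ne_zero
    rw [Finset.sum_eq_single i, hw'J i hi, PMF.uniformOfFinset_apply_of_mem (hne i) hxi,
      PMF.uniformOfFinset_apply_of_mem hS'ne hx, div_eq_mul_inv, mul_right_comm,
      ENNReal.mul_inv_cancel hcard (ENNReal.natCast_ne_top _), one_mul]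
    · intro j _ hji
      have hxj : x ∉ B j := Finset.disjoint_right.mp (hdisj j i hji) hxi
      rw [PMF.uniformOfFinset_apply_of_notMem (hne j) hxj, mul_zero]
    · exact fun h => absurd (Finset.mem_univ i) h
  · rw [PMF.uniformOfFinset_apply_of_notMem hS'ne hx]
    refine Finset.sum_eq_zero fun i _ => ?_
    by_cases hi : i ∈ J
    · have hxi : x ∉ B i := fun h => hx (hS' ▸ Finset.mem_biUnion.mpr ⟨i, hi, h⟩)
      rw [PMF.uniformOfFinset_apply_of_notMem (hne i) hxi, mul_zero]
    · rw [hw'I i hi, zero_mul]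
end
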